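/- In the group 𝔾̃, the images of the elements s and sa generate a free subsemigroup of rank 2: the monoid homomorphism from the free monoid on two generators to 𝔾̃ sending the first generator to s and the second to sa is injective. In particular, 𝔾̃ has exponential growth. -/

import Mathlib

/-- The commutator `[x, y] = x⁻¹y⁻¹xy`. -/
def commElt {M : Type*} [Group M] (x y : M) : M := x⁻¹ * y⁻¹ * x * y

/-- The ten relators of the finitely presented group `𝔾̃` on the generators
`a = 0`, `b = 1`, `c = 2`, `s = 3`. -/
def GtildeRels : Set (FreeGroup (Fin 4)) :=
  let fa := FreeGroup.of (0 : Fin 4)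
  let fb := FreeGroup.of (1 : Fin 4)
  let fc := FreeGroup.of (2 : Fin 4)
  let fs := FreeGroup.of (3 : Fin 4)
  {fa ^ 2,
    (fa * fc) ^ 4,
    commElt fc (fa * fb) ^ 2,
    commElt fc (fb * fa * fb) ^ 2,
    commElt fc (fa * fb * fa * fb * fa) ^ 2,
    commElt fc (fa * fb * fa * fb * fa * fb) ^ 2,
    commElt fc (fb * fa * fb * fa * fb * fa * fb) ^ 2,
    fs⁻¹ * fa * fs * fb⁻¹,
    fs⁻¹ * fb * fs * fc⁻¹,
    fs⁻¹ * fc * fs * (fa * fb * fa)⁻¹}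

/-- The finitely presented group `𝔾̃` with 4 generators and 10 relators. -/
abbrev Gtilde : Type := PresentedGroup GtildeRels

open Equiv

namespace TreeAut

/-- The permutation of binary words that flips the first letter. -/
def swap : Perm (List Bool) :=
  Function.Involutive.toPerm
    (fun w => match w with
      | [] => []
      | x :: w => (!x) :: w)
    (by rintro (_ | ⟨_ | _, w⟩) <;> rfl)

/-- The map acting by `g` below the letter `false` and by `h` below the letter `true`. -/
def pairFun (g h : List Bool → List Bool) : List Bool → List Bool
  | [] => []
  | false :: w => false :: g w
  | true :: w => true :: h w

/-- The homomorphism assembling two permutations of binary words, acting on the words that start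
with `false` and with `true` respectively. -/
def pair : Perm (List Bool) × Perm (List Bool) →* Perm (List Bool) where
  toFun p :=
    { toFun := pairFun p.1 p.2
      invFun := pairFun p.1.symm p.2.symm
      left_inv := by rintro (_ | ⟨_ | _, w⟩) <;> simp [pairFun]
      right_inv := by rintro (_ | ⟨_ | _, w⟩) <;> simp [pairFun] }
  map_one' := by ext1 (_ | ⟨_ | _, w⟩) <;> rfl
  map_mul' _ _ := by ext1 (_ | ⟨_ | _, w⟩) <;> rfl

theorem pair_injective : Function.Injective pair := by
  rintro ⟨g, h⟩ ⟨g', h'⟩ e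
  refine Prod.ext (Equiv.ext fun w => ?_) (Equiv.ext fun w => ?_)
  · simpa [pair, pairFun] using DFunLike.congr_fun e (false :: w)
  · simpa [pair, pairFun] using DFunLike.congr_fun e (true :: w)

theorem pair_ne_swap (p : Perm (List Bool) × Perm (List Bool)) : pair p ≠ swap := by
  intro e
  have h : false :: p.1 [] = [true] := DFunLike.congr_fun e [false]
  simp at h

theorem swap_mul_swap : swap * swap = 1 := by
  ext1 (_ | ⟨_ | _, w⟩) <;> rfl

theorem swap_mul_pair (g h : Perm (List Bool)) : swap * pair (g, h) = pair (h, g) * swap := by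
  ext1 (_ | ⟨_ | _, w⟩) <;> rfl

mutual

/-- The action of `b = (a, c)` on binary words. -/
def bFun : List Bool → List Bool
  | [] => []
  | false :: w => false :: swap w
  | true :: w => true :: cFun w

/-- The action of `c = (b, 1)` on binary words. -/
def cFun : List Bool → List Bool
  | [] => []
  | false :: w => false :: bFun w
  | true :: w => true :: w

end

theorem bFun_cFun_involutive (w : List Bool) : bFun (bFun w) = w ∧ cFun (cFun w) = w := by
  induction w with
  | nil => simp [bFun, cFun]
  | cons x w ih =>
    have h : swap (swap w) = w := DFunLike.congr_fun swap_mul_swap w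
    cases x <;> simp [bFun, cFun, ih, h]

/-- The tree automorphism `b = (a, c)`. -/
def b : Perm (List Bool) := Function.Involutive.toPerm bFun fun w => (bFun_cFun_involutive w).1

/-- The tree automorphism `c = (b, 1)`. -/
def c : Perm (List Bool) := Function.Involutive.toPerm cFun fun w => (bFun_cFun_involutive w).2

theorem b_eq_pair : b = pair (swap, c) := by
  ext1 (_ | ⟨_ | _, w⟩) <;> rfl

theorem c_eq_pair : c = pair (b, 1) := by
  ext1 (_ | ⟨_ | _, w⟩) <;> rfl

theorem b_mul_b : b * b = 1 :=
  Equiv.ext fun w => (bFun_cFun_involutive w).1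

theorem c_mul_c : c * c = 1 :=
  Equiv.ext fun w => (bFun_cFun_involutive w).2

theorem swap_mul_c_pow_four : (swap * c) ^ 4 = 1 := by
  have h : (swap * c) ^ 2 = pair (b, b) := by
    rw [pow_two, c_eq_pair, ← mul_assoc, swap_mul_pair, mul_assoc _ swap swap, swap_mul_swap,
      mul_one, ← map_mul]
    simp
  rw [show 4 = 2 * 2 from rfl, pow_mul, h, pow_two, ← map_mul]
  simp [b_mul_b, ← Prod.one_eq_mk]

theorem commElt_c_pow_two (g h : Perm (List Bool)) : commElt c (pair (g, h) * swap) ^ 2 = 1 := by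
  have hb : b⁻¹ = b := inv_eq_of_mul_eq_one_left b_mul_b
  have hs : swap⁻¹ = swap := inv_eq_of_mul_eq_one_left swap_mul_swap
  have h₁ : commElt c (pair (g, h) * swap) = pair (b, g⁻¹ * b * g) := by
    have h₂ : swap * pair (g⁻¹ * b * g, 1) = pair (1, g⁻¹ * b * g) * swap := swap_mul_pair _ _
    calc commElt c (pair (g, h) * swap)
        = c⁻¹ * (swap * ((pair (g, h))⁻¹ * c * pair (g, h)) * swap) := by
          simp only [commElt, mul_inv_rev, hs, mul_assoc]
      _ = c⁻¹ * (swap * pair (g⁻¹ * b * g, 1) * swap) := by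
          congr 3
          rw [c_eq_pair, ← map_inv, ← map_mul, ← map_mul]
          simp
      _ = pair (b, g⁻¹ * b * g) := by
          rw [h₂, mul_assoc _ swap swap, swap_mul_swap, mul_one, c_eq_pair, ← map_inv, ← map_mul]
          simp [hb]
  have h₃ : g⁻¹ * b * g * (g⁻¹ * b * g) = 1 := by
    rw [show g⁻¹ * b * g * (g⁻¹ * b * g) = g⁻¹ * (b * b) * g by group, b_mul_b]
    group
  rw [h₁, pow_two, ← map_mul, Prod.mk_mul_mk, b_mul_b, h₃, ← Prod.one_eq_mk, map_one]

/-- The vertex group: besides a tree automorphism it records the values of homomorphisms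
that are needed to extend the substitution `a ↦ b ↦ c ↦ aba`. -/
abbrev Base : Type :=
  Perm (List Bool) × Perm (List Bool) × Perm (List Bool) × Perm (List Bool)

/-- The endomorphism extending the substitution `a ↦ b ↦ c ↦ aba`. -/
def subst : Base →* Base where
  toFun x := (pair (x.1, x.2.1), x.2.2.2, x.2.2.2, x.2.2.1)
  map_one' := by simp [← Prod.one_eq_mk]
  map_mul' x y := by simp [← map_mul]

theorem subst_injective : Function.Injective subst := by
  rintro ⟨g, d, p, q⟩ ⟨g', d', p', q'⟩ e
  simp only [subst, MonoidHom.coe_mk, OneHom.coe_mk, Prod.mk.injEq] at e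
  obtain ⟨e₁, e₂, -, e₃⟩ := e
  have := pair_injective e₁
  simp_all

/-- The image of the generator `a` in the vertex group. -/
def baseA : Base := (swap, c, swap, 1)

/-- The image of the generator `b` in the vertex group. -/
def baseB : Base := (b, 1, 1, swap)

/-- The image of the generator `c` in the vertex group. -/
def baseC : Base := (c, swap, swap, 1)

theorem subst_ne_baseA (x : Base) : subst x ≠ baseA := fun e =>
  pair_ne_swap _ (congrArg Prod.fst e)

theorem subst_baseA : subst baseA = baseB := by
  simp [subst, baseA, baseB, b_eq_pair]

theorem subst_baseB : subst baseB = baseC := by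
  simp [subst, baseB, baseC, c_eq_pair]

theorem subst_baseC : subst baseC = baseA * baseB * baseA := by
  have h : swap * b * swap = pair (c, swap) := by
    rw [b_eq_pair, swap_mul_pair, mul_assoc, swap_mul_swap, mul_one]
  simp [subst, baseA, baseB, baseC, h, c_mul_c, swap_mul_swap]

theorem baseA_pow_two : baseA ^ 2 = 1 := by
  simp [baseA, pow_two, swap_mul_swap, c_mul_c, ← Prod.one_eq_mk]

theorem baseA_mul_baseC_pow_four : (baseA * baseC) ^ 4 = 1 := by
  have h : (c * swap) ^ 4 = 1 := by
    rw [← inv_inj, ← inv_pow, mul_inv_rev, inv_eq_of_mul_eq_one_left c_mul_c,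
      inv_eq_of_mul_eq_one_left swap_mul_swap, swap_mul_c_pow_four, inv_one]
  simp [baseA, baseC, swap_mul_swap, swap_mul_c_pow_four, h, ← Prod.one_eq_mk]

/-- Elements of the vertex group that flip the first letter and whose second and third coordinates
agree with those of `baseA`. -/
def IsFlip (x : Base) : Prop :=
  ∃ g h q, x = (pair (g, h) * swap, c, swap, q)

theorem isFlip_baseA : IsFlip baseA :=
  ⟨1, 1, 1, by simp [baseA, ← Prod.one_eq_mk]⟩

theorem IsFlip.mul_baseB {x : Base} (hx : IsFlip x) : IsFlip (x * baseB) := by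
  obtain ⟨g, h, q, rfl⟩ := hx
  refine ⟨g * c, h * swap, q * swap, ?_⟩
  have e : pair (g, h) * swap * b = pair (g * c, h * swap) * swap := by
    rw [b_eq_pair, mul_assoc, swap_mul_pair, ← mul_assoc, ← map_mul, Prod.mk_mul_mk]
  simp [baseB, e]

theorem IsFlip.baseB_mul {x : Base} (hx : IsFlip x) : IsFlip (baseB * x) := by
  obtain ⟨g, h, q, rfl⟩ := hx
  refine ⟨swap * g, c * h, swap * q, ?_⟩
  have e : b * (pair (g, h) * swap) = pair (swap * g, c * h) * swap := by
    rw [b_eq_pair, ← mul_assoc, ← map_mul, Prod.mk_mul_mk]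
  simp [baseB, e]

theorem IsFlip.baseA_mul_mul_baseA {x : Base} (hx : IsFlip x) : IsFlip (baseA * x * baseA) := by
  obtain ⟨g, h, q, rfl⟩ := hx
  refine ⟨h, g, q, ?_⟩
  have e : swap * (pair (g, h) * swap) * swap = pair (h, g) * swap := by
    rw [mul_assoc, mul_assoc, swap_mul_swap, mul_one, swap_mul_pair]
  simp [baseA, e, c_mul_c, swap_mul_swap]

theorem IsFlip.commElt_baseC_pow_two {x : Base} (hx : IsFlip x) : commElt baseC x ^ 2 = 1 := by
  obtain ⟨g, h, q, rfl⟩ := hx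
  have hs : swap⁻¹ = swap := inv_eq_of_mul_eq_one_left swap_mul_swap
  have hc : c⁻¹ = c := inv_eq_of_mul_eq_one_left c_mul_c
  have h₁ : commElt swap c ^ 2 = 1 := by
    rw [← swap_mul_c_pow_four, show 4 = 2 * 2 from rfl, pow_mul, pow_two (swap * c)]
    simp only [commElt, hs, hc, mul_assoc]
  have h₂ := commElt_c_pow_two g h
  simp only [commElt, mul_inv_rev] at h₁ h₂
  simp [commElt, baseC, h₁, h₂, ← Prod.one_eq_mk]

/-- The ascending HNN extension of the vertex group along the substitution. -/
abbrev Ext : Type :=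
  HNNExtension Base ⊤ subst.range
    (Subgroup.topEquiv.trans (MonoidHom.ofInjective subst_injective))

theorem t_mul_of (x : Base) : (HNNExtension.t : Ext) * HNNExtension.of x =
    HNNExtension.of (subst x) * HNNExtension.t :=
  HNNExtension.t_mul_of (⟨x, trivial⟩ : (⊤ : Subgroup Base))

theorem of_mul_t_inv (x : Base) : (HNNExtension.of x : Ext) * HNNExtension.t⁻¹ =
    HNNExtension.t⁻¹ * HNNExtension.of (subst x) := by
  rw [mul_inv_eq_iff_eq_mul, mul_assoc, ← t_mul_of, inv_mul_cancel_left]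

/-- The homomorphism sending the stable letter to `1` and the vertex group to `0`. -/
noncomputable def height : Ext →* Multiplicative ℤ :=
  HNNExtension.lift 1 (Multiplicative.ofAdd 1) (by simp)

/-- The images of the four generators in the HNN extension. -/
noncomputable def gens : Fin 4 → Ext :=
  ![HNNExtension.of baseA, HNNExtension.of baseB, HNNExtension.of baseC, HNNExtension.t⁻¹]

theorem lift_gens_eq_one : ∀ r ∈ GtildeRels, FreeGroup.lift gens r = 1 := by
  have hconj {x y : Base} (h : TreeAut.subst x = y) :
      (HNNExtension.t⁻¹ : Ext)⁻¹ * HNNExtension.of x * HNNExtension.t⁻¹ *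
        (HNNExtension.of y)⁻¹ = 1 := by
    rw [inv_inv, t_mul_of, h]
    group
  have hcomm {x : Base} (hx : IsFlip x) :
      commElt (HNNExtension.of baseC : Ext) (HNNExtension.of x) ^ 2 = 1 := by
    simpa [commElt] using congrArg (HNNExtension.of : Base →* Ext) hx.commElt_baseC_pow_two
  have hAB := isFlip_baseA.mul_baseB
  have hBAB := isFlip_baseA.baseB_mul.mul_baseB
  have hABABA := hBAB.baseA_mul_mul_baseA
  have hABABAB := hABABA.mul_baseB
  have hBABABAB := hABABAB.baseB_mul
  intro r hr
  simp only [GtildeRels, Set.mem_insert_iff, Set.mem_singleton_iff] at hr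
  rcases hr with rfl | rfl | rfl | rfl | rfl | rfl | rfl | rfl | rfl | rfl
  · simpa [gens] using congrArg (HNNExtension.of : Base →* Ext) baseA_pow_two
  · simpa [gens] using congrArg (HNNExtension.of : Base →* Ext) baseA_mul_baseC_pow_four
  · simpa [gens, commElt, mul_assoc] using hcomm hAB
  · simpa [gens, commElt, mul_assoc] using hcomm hBAB
  · simpa [gens, commElt, mul_assoc] using hcomm hABABA
  · simpa [gens, commElt, mul_assoc] using hcomm hABABAB
  · simpa [gens, commElt, mul_assoc] using hcomm hBABABAB
  · simpa [gens] using hconj subst_baseA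
  · simpa [gens] using hconj subst_baseB
  · simpa [gens, mul_assoc] using hconj subst_baseC

/-- The homomorphism from `Gtilde` to the HNN extension. -/
noncomputable def toExt : Gtilde →* Ext := PresentedGroup.toGroup lift_gens_eq_one

/-- The vertex group part of a word in `s` and `sa`, read from its last letter. -/
def wordValue : List (Fin 2) → Base
  | [] => 1
  | i :: w => subst (wordValue w) * ![1, baseA] i

theorem wordValue_injective_of_length_eq {u v : List (Fin 2)} (hl : u.length = v.length)
    (h : wordValue u = wordValue v) : u = v := by
  induction u generalizing v with
  | nil => exact (List.length_eq_zero_iff.1 hl.symm).symm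
  | cons i u ih =>
    obtain _ | ⟨j, v⟩ := v
    · simp at hl
    have key {x y : Base} : subst x * baseA ≠ subst y := fun e =>
      subst_ne_baseA (x⁻¹ * y) (by rw [map_mul, map_inv, ← e, inv_mul_cancel_left])
    have hij : i = j := by
      fin_cases i <;> fin_cases j <;> simp [wordValue, key, key.symm] at h ⊢
    subst hij
    rw [ih (by simpa using hl) (subst_injective (mul_right_cancel h))]

theorem prod_reverse_map (w : List (Fin 2)) :
    ((w.map ![(HNNExtension.t⁻¹ : Ext), HNNExtension.t⁻¹ * HNNExtension.of baseA]).reverse).prod =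
      HNNExtension.t⁻¹ ^ w.length * HNNExtension.of (wordValue w) := by
  induction w with
  | nil => simp [wordValue]
  | cons i w ih =>
    have hi : ![(HNNExtension.t⁻¹ : Ext), HNNExtension.t⁻¹ * HNNExtension.of baseA] i =
        HNNExtension.t⁻¹ * HNNExtension.of (![1, baseA] i) := by
      fin_cases i <;> simp
    rw [List.map_cons, List.reverse_cons, List.prod_append, ih, List.prod_singleton, hi,
      List.length_cons, pow_succ, wordValue, map_mul, ← mul_assoc, mul_assoc _ (HNNExtension.of _),
      of_mul_t_inv]
    simp only [mul_assoc]

theorem lift_injective : Function.Injective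
    (FreeMonoid.lift ![(HNNExtension.t⁻¹ : Ext), HNNExtension.t⁻¹ * HNNExtension.of baseA]) := by
  intro u v h
  have hw (w : FreeMonoid (Fin 2)) := prod_reverse_map w.toList.reverse
  simp only [List.map_reverse, List.reverse_reverse] at hw
  rw [FreeMonoid.lift_apply, FreeMonoid.lift_apply, hw, hw] at h
  have hl : u.toList.reverse.length = v.toList.reverse.length := by
    have := congrArg (fun x => Multiplicative.toAdd (height x)) h
    simpa [height] using this
  rw [hl] at h
  have := wordValue_injective_of_length_eq hl (HNNExtension.of_injective _ (mul_left_cancel h))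
  exact FreeMonoid.toList.injective (List.reverse_injective this)

end TreeAut

/-- the images of `s` and `sa` generate a free subsemigroup of rank 2 of
`𝔾̃`: the monoid homomorphism from the free monoid on two generators to `𝔾̃` sending the
first generator to `s` and the second to `s·a` is injective. -/
theorem Gtilde_free_subsemigroup :
    Function.Injective
      ⇑(FreeMonoid.lift (![PresentedGroup.of 3,
          PresentedGroup.of 3 * PresentedGroup.of 0] : Fin 2 → Gtilde)) := by
  refine Function.Injective.of_comp (f := TreeAut.toExt) ?_
  rw [← MonoidHom.coe_comp]
  convert TreeAut.lift_injective using 2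
  ext i
  fin_cases i <;> simp [TreeAut.toExt, TreeAut.gens]
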